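/- Consider the semidiscrete SD-RT(1) scheme on the right-triangular mesh with transport velocity ω = (ω_x, ω_y), ω_x > 0, ω_y = 0. Then for every 1-periodic v0 ∈ C³(ℝ²) there exists a constant c (depending on v0) such that the solution error satisfies ‖ε_h(t, v0)‖ ≤ c·(h + t·h²) for all N and all t ≥ 0 (second-order accuracy in long-time simulation). -/

import Mathlib

open Matrix

noncomputable section

/-- Coefficient matrix `L^x_{(0,0)}` of the SD-RT(1) scheme. -/
def Lx00 : Matrix (Fin 6) (Fin 6) ℝ :=
  !![3,1,1,0,0,0; -3,1,-2,0,0,0; 0,1,4,0,0,0;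
     0,-1,-4,3,1,1; 0,2,2,-3,1,-2; 0,-4,-1,0,1,4]

/-- Coefficient matrix `L^x_{(-1,0)}` of the SD-RT(1) scheme. -/
def Lxm : Matrix (Fin 6) (Fin 6) ℝ :=
  !![0,0,0,0,-1,-4; 0,0,0,0,2,2; 0,0,0,0,-4,-1;
     0,0,0,0,0,0; 0,0,0,0,0,0; 0,0,0,0,0,0]

/-- Coefficient matrix `L^y_{(0,0)}` of the SD-RT(1) scheme. -/
def Ly00 : Matrix (Fin 6) (Fin 6) ℝ :=
  !![3,1,1,0,0,0; 0,4,1,0,0,0; -3,-2,1,0,0,0;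
     0,-1,-4,4,1,0; 0,2,2,-2,1,-3; 0,-4,-1,1,1,3]

/-- Coefficient matrix `L^y_{(0,-1)}` of the SD-RT(1) scheme. -/
def Lym : Matrix (Fin 6) (Fin 6) ℝ :=
  !![0,0,0,-4,-1,0; 0,0,0,-1,-4,0; 0,0,0,2,2,0;
     0,0,0,0,0,0; 0,0,0,0,0,0; 0,0,0,0,0,0]

/-- `L_{(0,0)} = ω_x · Lx00 + ω_y · Ly00`. -/
def L00 (ω : ℝ × ℝ) : Matrix (Fin 6) (Fin 6) ℝ := ω.1 • Lx00 + ω.2 • Ly00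

/-- `L_{(-1,0)} = ω_x · Lxm`. -/
def Lm0 (ω : ℝ × ℝ) : Matrix (Fin 6) (Fin 6) ℝ := ω.1 • Lxm

/-- `L_{(0,-1)} = ω_y · Lym`. -/
def L0m (ω : ℝ × ℝ) : Matrix (Fin 6) (Fin 6) ℝ := ω.2 • Lym

/-- `L(0) = L_{(0,0)} + L_{(-1,0)} + L_{(0,-1)}`. -/
def Lzero (ω : ℝ × ℝ) : Matrix (Fin 6) (Fin 6) ℝ := L00 ω + Lm0 ω + L0m ω

/-- Solution points `a_1,…,a_6` of the reference block. -/
def apt : Fin 6 → ℝ × ℝ := ![(0,0), (1,0), (0,1), (0,1), (1,1), (1,0)]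

/-- A mesh function on the periodic mesh with `N × N` blocks. -/
abbrev Mesh (N : ℕ) := (ZMod N × ZMod N) → (Fin 6 → ℝ)

/-- The norm `‖u‖² = Σ_η h² |u_η|²` with `h = 1/N` (Euclidean norm on `ℝ^6`). -/
def meshNorm (N : ℕ) [NeZero N] (u : Mesh N) : ℝ :=
  Real.sqrt (∑ η : ZMod N × ZMod N, ((1 : ℝ) / N) ^ 2 * ∑ ξ : Fin 6, (u η ξ) ^ 2)

/-- The Lagrangian mapping `Π_h`, `h = 1/N`: `(Π_h v)_{η,ξ} = v((η + a_ξ)h)`. -/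
def Pih (N : ℕ) [NeZero N] (v : ℝ × ℝ → ℝ) : Mesh N :=
  fun η ξ => v ((((η.1.val : ℝ) + (apt ξ).1) / N, ((η.2.val : ℝ) + (apt ξ).2) / N))

/-- 1-periodicity in both variables. -/
def Periodic2 (v : ℝ × ℝ → ℝ) : Prop :=
  (∀ x y : ℝ, v (x + 1, y) = v (x, y)) ∧ (∀ x y : ℝ, v (x, y + 1) = v (x, y))

/-- `u : ℝ → Mesh N` solves the semidiscrete SD-RT(1) scheme
`du_η/dt + (1/h) Σ_{ζ∈S} L_ζ u_{η+ζ} = 0`, `h = 1/N`. -/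
def IsSol (ω : ℝ × ℝ) (N : ℕ) [NeZero N] (u : ℝ → Mesh N) : Prop :=
  ∀ (η : ZMod N × ZMod N) (t : ℝ),
    HasDerivAt (fun s => u s η)
      (-((N : ℝ) • (L00 ω *ᵥ u t η + Lm0 ω *ᵥ u t (η + (-1, 0))
          + L0m ω *ᵥ u t (η + (0, -1))))) t

/-- The upwind operator `Lx00 x + Lxm y` of the scheme for horizontal transport: `x` is the state
of a block and `y` that of its left neighbour. -/
def upwind (x y : Fin 6 → ℝ) : Fin 6 → ℝ := Lx00 *ᵥ x + Lxm *ᵥ y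

lemma upwind_eq (x y : Fin 6 → ℝ) : upwind x y =
    ![3 * x 0 + x 1 + x 2 - y 4 - 4 * y 5,
      -3 * x 0 + x 1 - 2 * x 2 + 2 * y 4 + 2 * y 5,
      x 1 + 4 * x 2 - 4 * y 4 - y 5,
      3 * x 3 + x 4 + x 5 - x 1 - 4 * x 2,
      -3 * x 3 + x 4 - 2 * x 5 + 2 * x 1 + 2 * x 2,
      x 4 + 4 * x 5 - 4 * x 1 - x 2] := by
  ext ξ
  fin_cases ξ <;>
    simp [upwind, Lx00, Lxm, dotProduct, Fin.sum_univ_succ] <;> ring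

lemma upwind_sub (x x' y y' : Fin 6 → ℝ) :
    upwind (x - x') (y - y') = upwind x y - upwind x' y' := by
  simp only [upwind, Matrix.mulVec_sub]
  abel

/-- The inner product on block states in which the scheme is dissipative. -/
def blockInner (x y : Fin 6 → ℝ) : ℝ :=
  3 * (x 0 * y 0 + x 1 * y 1 + x 2 * y 2 + x 3 * y 3 + x 4 * y 4 + x 5 * y 5)
    + 2 * ((x 0 + x 1 + x 2) * (y 0 + y 1 + y 2)) + 2 * ((x 3 + x 4 + x 5) * (y 3 + y 4 + y 5))

/-- The energy flux through the right face of a block. -/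
def faceFlux (x : Fin 6 → ℝ) : ℝ := 9 * (x 4 ^ 2 + x 5 ^ 2 + x 4 * x 5)

lemma faceFlux_sub_le_blockInner_upwind (x y : Fin 6 → ℝ) :
    faceFlux x - faceFlux y ≤ blockInner x (upwind x y) := by
  have key : blockInner x (upwind x y) - (faceFlux x - faceFlux y) =
      9 / 2 * ((x 0 - y 5) ^ 2 + (x 2 - y 4) ^ 2 + (x 0 - y 5 + (x 2 - y 4)) ^ 2
        + (x 3 - x 2) ^ 2 + (x 5 - x 1) ^ 2 + (x 3 - x 2 + (x 5 - x 1)) ^ 2) := by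
    simp [blockInner, faceFlux, upwind_eq]
    ring
  have : 0 ≤ blockInner x (upwind x y) - (faceFlux x - faceFlux y) := by
    rw [key]; positivity
  linarith

lemma blockInner_self_nonneg (x : Fin 6 → ℝ) : 0 ≤ blockInner x x := by
  unfold blockInner
  simp only [← pow_two]
  positivity

lemma sum_sq_le_blockInner_self (x : Fin 6 → ℝ) : 3 * ∑ ξ, x ξ ^ 2 ≤ blockInner x x := by
  have h1 := sq_nonneg (x 0 + x 1 + x 2)
  have h2 := sq_nonneg (x 3 + x 4 + x 5)
  simp only [Fin.sum_univ_six, blockInner]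
  linarith

lemma blockInner_self_le (x : Fin 6 → ℝ) {B : ℝ} (hx : ∀ ξ, |x ξ| ≤ B) :
    blockInner x x ≤ 54 * B ^ 2 := by
  have h : ∀ ξ, x ξ ^ 2 ≤ B ^ 2 := fun ξ => sq_le_sq' (abs_le.1 (hx ξ)).1 (abs_le.1 (hx ξ)).2
  unfold blockInner
  linarith [h 0, h 1, h 2, h 3, h 4, h 5, sq_nonneg (x 0 - x 1), sq_nonneg (x 0 - x 2),
    sq_nonneg (x 1 - x 2), sq_nonneg (x 3 - x 4), sq_nonneg (x 3 - x 5), sq_nonneg (x 4 - x 5)]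

lemma neg_two_mul_blockInner_le (x y : Fin 6 → ℝ) {s : ℝ} (hs : 0 < s) :
    -(2 * blockInner x y) ≤ s * blockInner x x + blockInner y y / s := by
  have h : s * blockInner x x + 2 * blockInner x y + blockInner y y / s
      = blockInner (s • x + y) (s • x + y) / s := by
    simp only [blockInner, Pi.add_apply, Pi.smul_apply, smul_eq_mul]
    field_simp
    ring
  have := div_nonneg (blockInner_self_nonneg (s • x + y)) hs.le
  linarith

lemma HasDerivAt.blockInner_self {e : ℝ → Fin 6 → ℝ} {e' : Fin 6 → ℝ} {t : ℝ}
    (he : ∀ ξ, HasDerivAt (fun s => e s ξ) (e' ξ) t) :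
    HasDerivAt (fun s => blockInner (e s) (e s)) (2 * blockInner (e t) e') t := by
  have hl := ((he 0).fun_add (he 1)).fun_add (he 2)
  have hu := ((he 3).fun_add (he 4)).fun_add (he 5)
  have hd := ((((((((he 0).fun_mul (he 0)).fun_add ((he 1).fun_mul (he 1))).fun_add
    ((he 2).fun_mul (he 2))).fun_add ((he 3).fun_mul (he 3))).fun_add
    ((he 4).fun_mul (he 4))).fun_add ((he 5).fun_mul (he 5))).const_mul 3).fun_add
    ((hl.fun_mul hl).const_mul 2) |>.fun_add ((hu.fun_mul hu).const_mul 2)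
  refine hd.congr_deriv ?_
  unfold blockInner
  ring

/-- The discrete energy associated with `blockInner`. -/
def meshEnergy (N : ℕ) [NeZero N] (u : Mesh N) : ℝ :=
  ∑ η : ZMod N × ZMod N, ((1 : ℝ) / N) ^ 2 * blockInner (u η) (u η)

lemma meshEnergy_nonneg (N : ℕ) [NeZero N] (u : Mesh N) : 0 ≤ meshEnergy N u :=
  Finset.sum_nonneg fun η _ => mul_nonneg (sq_nonneg _) (blockInner_self_nonneg (u η))

lemma sum_mesh_const (N : ℕ) [NeZero N] (B : ℝ) :
    ∑ _η : ZMod N × ZMod N, ((1 : ℝ) / N) ^ 2 * B = B := by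
  have hN : (N : ℝ) ≠ 0 := Nat.cast_ne_zero.2 (NeZero.ne N)
  simp [ZMod.card]
  field_simp

lemma sum_mesh_le (N : ℕ) [NeZero N] {B : ℝ} {f : ZMod N × ZMod N → ℝ} (hf : ∀ η, f η ≤ B) :
    ∑ η : ZMod N × ZMod N, ((1 : ℝ) / N) ^ 2 * f η ≤ B := by
  rw [← sum_mesh_const N B]
  exact Finset.sum_le_sum fun η _ => mul_le_mul_of_nonneg_left (hf η) (sq_nonneg _)

lemma sum_blockInner_upwind_nonneg (N : ℕ) [NeZero N] (e : Mesh N) :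
    0 ≤ ∑ η : ZMod N × ZMod N,
      ((1 : ℝ) / N) ^ 2 * blockInner (e η) (upwind (e η) (e (η + (-1, 0)))) := by
  have hshift : ∑ η : ZMod N × ZMod N, ((1 : ℝ) / N) ^ 2 * faceFlux (e (η + (-1, 0)))
      = ∑ η : ZMod N × ZMod N, ((1 : ℝ) / N) ^ 2 * faceFlux (e η) :=
    Equiv.sum_comp (Equiv.addRight ((-1, 0) : ZMod N × ZMod N))
      fun η => ((1 : ℝ) / N) ^ 2 * faceFlux (e η)
  calc (0 : ℝ) = ∑ η : ZMod N × ZMod N,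
        ((1 : ℝ) / N) ^ 2 * (faceFlux (e η) - faceFlux (e (η + (-1, 0)))) := by
        simp only [mul_sub, Finset.sum_sub_distrib, hshift, sub_self]
    _ ≤ _ := Finset.sum_le_sum fun η _ => mul_le_mul_of_nonneg_left
        (faceFlux_sub_le_blockInner_upwind _ _) (sq_nonneg _)

/-- Stability of the scheme perturbed by a bounded residual. -/
lemma sqrt_meshEnergy_le {N : ℕ} [NeZero N] {a ρ δ : ℝ} (ha : 0 ≤ a) (hρ : 0 < ρ) (hδ : 0 < δ)
    {e r : ℝ → Mesh N}
    (he : ∀ η ξ t, HasDerivAt (fun s => e s η ξ)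
      (-(a * N * upwind (e t η) (e t (η + (-1, 0))) ξ) - r t η ξ) t)
    (hr : ∀ t η, blockInner (r t η) (r t η) ≤ ρ ^ 2) {t : ℝ} (ht : 0 ≤ t) :
    √(meshEnergy N (e t) + δ) ≤ √(meshEnergy N (e 0) + δ) + ρ * t := by
  set E : ℝ → ℝ := fun t => meshEnergy N (e t) with hE
  have hpos : ∀ t, 0 < E t + δ := fun t => add_pos_of_nonneg_of_pos (meshEnergy_nonneg N _) hδ
  have hderiv : ∀ t, ∃ E', HasDerivAt E E' t ∧ E' ≤ 2 * ρ * √(E t + δ) := by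
    intro t
    refine ⟨_, HasDerivAt.fun_sum fun η _ =>
      (HasDerivAt.blockInner_self fun ξ => he η ξ t).const_mul (((1 : ℝ) / N) ^ 2), ?_⟩
    set g := √(E t + δ) with hg
    have hg0 : 0 < g := Real.sqrt_pos.2 (hpos t)
    have hgsq : g ^ 2 = E t + δ := Real.sq_sqrt (hpos t).le
    have hterm : ∀ η : ZMod N × ZMod N,
        ((1 : ℝ) / N) ^ 2 * (2 * blockInner (e t η) (fun ξ =>
          -(a * N * upwind (e t η) (e t (η + (-1, 0))) ξ) - r t η ξ))
        ≤ -(2 * a * N) * (((1 : ℝ) / N) ^ 2 *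
            blockInner (e t η) (upwind (e t η) (e t (η + (-1, 0)))))
          + (ρ / g * (((1 : ℝ) / N) ^ 2 * blockInner (e t η) (e t η))
          + ((1 : ℝ) / N) ^ 2 * (ρ * g)) := by
      intro η
      have hsplit : 2 * blockInner (e t η) (fun ξ =>
          -(a * N * upwind (e t η) (e t (η + (-1, 0))) ξ) - r t η ξ)
          = -(2 * a * N) * blockInner (e t η) (upwind (e t η) (e t (η + (-1, 0))))
            + -(2 * blockInner (e t η) (r t η)) := by
        unfold blockInner
        ring
      have hy := neg_two_mul_blockInner_le (e t η) (r t η) (div_pos hρ hg0)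
      have hq : blockInner (r t η) (r t η) / (ρ / g) ≤ ρ * g := by
        rw [div_le_iff₀ (div_pos hρ hg0)]
        calc _ ≤ ρ ^ 2 := hr t η
          _ = ρ * g * (ρ / g) := by field_simp
      rw [hsplit]
      have := mul_le_mul_of_nonneg_left (hy.trans (add_le_add_right hq _))
        (sq_nonneg ((1 : ℝ) / N))
      linarith
    calc _ ≤ _ := Finset.sum_le_sum fun η _ => hterm η
      _ = -(2 * a * N) * (∑ η : ZMod N × ZMod N, ((1 : ℝ) / N) ^ 2 *
            blockInner (e t η) (upwind (e t η) (e t (η + (-1, 0)))))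
          + (ρ / g * E t + ρ * g) := by
        simp only [hE, meshEnergy]
        rw [Finset.sum_add_distrib, Finset.sum_add_distrib, sum_mesh_const,
          Finset.mul_sum _ _ (-(2 * a * N)), Finset.mul_sum _ _ (ρ / g)]
      _ ≤ ρ / g * E t + ρ * g := by
        have h1 := sum_blockInner_upwind_nonneg N (e t)
        have h2 : 0 ≤ 2 * a * N := by positivity
        nlinarith [mul_nonneg h2 h1]
      _ ≤ ρ / g * g ^ 2 + ρ * g := by
        have : E t ≤ g ^ 2 := by linarith
        gcongr
      _ = 2 * ρ * g := by field_simp; ring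
  choose E' hE' hE'le using hderiv
  have hsq : ∀ t, HasDerivAt (fun s => √(E s + δ)) (E' t / (2 * √(E t + δ))) t := fun t =>
    ((hE' t).add_const δ).sqrt (hpos t).ne'
  have hle : ∀ t, deriv (fun s => √(E s + δ)) t ≤ ρ := by
    intro t
    have hg0 : 0 < √(E t + δ) := Real.sqrt_pos.2 (hpos t)
    rw [(hsq t).deriv, div_le_iff₀ (by positivity)]
    linarith [hE'le t]
  have := image_sub_le_mul_sub_of_deriv_le (fun t => (hsq t).differentiableAt) hle ht
  simp only [sub_zero] at this
  linarith

lemma abs_le_of_abs_deriv_le {f f' : ℝ → ℝ} {h C : ℝ} (hh : 0 ≤ h) (h0 : f 0 = 0)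
    (hf : ∀ s, HasDerivAt f (f' s) s) (hb : ∀ s ∈ Set.Icc 0 h, |f' s| ≤ C) :
    |f h| ≤ C * h := by
  have := (convex_Icc 0 h).norm_image_sub_le_of_norm_hasDerivWithin_le
    (fun s _ => (hf s).hasDerivWithinAt) hb (Set.left_mem_Icc.2 hh) (Set.right_mem_Icc.2 hh)
  simpa [h0, abs_of_nonneg hh] using this

section Taylor

variable {g g₁ g₂ g₃ : ℝ → ℝ} {K h : ℝ}

lemma abs_backward_diff_le (hh : 0 ≤ h) (hg : ∀ x, HasDerivAt g (g₁ x) x)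
    (hK : ∀ x, |g₁ x| ≤ K) (x : ℝ) : |g (x - h) - g x| ≤ K * h :=
  abs_le_of_abs_deriv_le (f := fun s => g (x - s) - g x) hh (by simp)
    (fun s => ((hg (x - s)).comp_const_sub x s).sub_const _)
    fun s _ => by simpa using hK (x - s)

lemma abs_backward_taylor_one_le (hh : 0 ≤ h) (hg : ∀ x, HasDerivAt g (g₁ x) x)
    (hg₁ : ∀ x, HasDerivAt g₁ (g₂ x) x) (hK : ∀ x, |g₂ x| ≤ K) (x : ℝ) :
    |g (x - h) - g x + h * g₁ x| ≤ K * h ^ 2 := by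
  have hK0 : 0 ≤ K := (abs_nonneg _).trans (hK 0)
  have := abs_le_of_abs_deriv_le (f := fun s => g (x - s) - g x + s * g₁ x)
    (C := K * h) hh (by simp)
    (fun s => (((hg (x - s)).comp_const_sub x s).sub_const _).fun_add
      ((hasDerivAt_id s).mul_const _))
    fun s hs => by
      have h1 := abs_backward_diff_le hs.1 hg₁ hK x
      rw [one_mul, neg_add_eq_sub, abs_sub_comm]
      exact h1.trans (mul_le_mul_of_nonneg_left hs.2 hK0)
  simpa [pow_two, mul_assoc] using this

lemma abs_backward_taylor_two_le (hh : 0 ≤ h) (hg : ∀ x, HasDerivAt g (g₁ x) x)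
    (hg₁ : ∀ x, HasDerivAt g₁ (g₂ x) x) (hg₂ : ∀ x, HasDerivAt g₂ (g₃ x) x)
    (hK : ∀ x, |g₃ x| ≤ K) (x : ℝ) :
    |g (x - h) - g x + h * g₁ x - h ^ 2 / 2 * g₂ x| ≤ K * h ^ 3 := by
  have hK0 : 0 ≤ K := (abs_nonneg _).trans (hK 0)
  have := abs_le_of_abs_deriv_le
    (f := fun s => g (x - s) - g x + s * g₁ x - s ^ 2 / 2 * g₂ x)
    (f' := fun s => -(g₁ (x - s) - g₁ x + s * g₂ x))
    (C := K * h ^ 2) hh (by simp)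
    (fun s => (((((hg (x - s)).comp_const_sub x s).sub_const _).fun_add
      ((hasDerivAt_id s).mul_const _)).fun_sub
        ((((hasDerivAt_id s).fun_pow 2).div_const 2).mul_const _)).congr_deriv
          (by simp; ring))
    fun s hs => by
      have h1 := abs_backward_taylor_one_le hs.1 hg₁ hg₂ hK x
      rw [abs_neg]
      exact h1.trans (mul_le_mul_of_nonneg_left (pow_le_pow_left₀ hs.1 hs.2 2) hK0)
  calc _ ≤ _ := this
    _ = K * h ^ 3 := by ring

end Taylor

/-- First-order coefficients of the corrected projection. -/
def corrOne : Fin 6 → ℝ := ![-1/4, 3/4, 1/4, 1/4, 5/4, 3/4]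

/-- Second-order coefficients of the corrected projection. -/
def corrTwo : Fin 6 → ℝ := ![-1/8, 7/24, 7/24, 1/8, 25/24, 7/24]

/-- Block state with component `ξ` equal to `g₀ + h c₁ g₁ + h² c₂ g₂`, for the
coefficients `c₁ = corrOne ξ` and `c₂ = corrTwo ξ`. -/
def corrState (h g₀ g₁ g₂ : ℝ) : Fin 6 → ℝ :=
  fun ξ => g₀ + h * corrOne ξ * g₁ + h ^ 2 * corrTwo ξ * g₂

lemma abs_corrOne_le (ξ : Fin 6) : |corrOne ξ| ≤ 2 := by
  fin_cases ξ <;> norm_num [corrOne, abs_le]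

lemma abs_corrTwo_le (ξ : Fin 6) : |corrTwo ξ| ≤ 2 := by
  fin_cases ξ <;> norm_num [corrTwo, abs_le]

lemma upwind_corrState (h g₀ g₁ g₂ k₀ k₁ k₂ : ℝ) (ξ : Fin 6) :
    upwind (corrState h g₀ g₁ g₂) (corrState h k₀ k₁ k₂) ξ
      = h * g₁ + h ^ 2 * corrOne ξ * g₂
        + (Lxm *ᵥ 1) ξ * (k₀ - g₀ + h * g₁ - h ^ 2 / 2 * g₂)
        + (Lxm *ᵥ corrOne) ξ * (h * (k₁ - g₁ + h * g₂))
        + (Lxm *ᵥ corrTwo) ξ * (h ^ 2 * (k₂ - g₂)) := by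
  rw [upwind_eq]
  fin_cases ξ <;>
    simp [Lxm, corrState, corrOne, corrTwo, Matrix.mulVec, dotProduct, Fin.sum_univ_succ] <;> ring

lemma abs_Lxm_mulVec_le (ξ : Fin 6) :
    |(Lxm *ᵥ 1) ξ| ≤ 6 ∧ |(Lxm *ᵥ corrOne) ξ| ≤ 6 ∧ |(Lxm *ᵥ corrTwo) ξ| ≤ 6 := by
  fin_cases ξ <;>
    norm_num [Lxm, corrOne, corrTwo, Matrix.mulVec, dotProduct, Fin.sum_univ_succ, abs_le]

/-- Consistency of the corrected projection. -/
lemma abs_corrState_residual_le {a n h K : ℝ} (ha : 0 ≤ a) (hh : 0 ≤ h) (hn : n * h = 1)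
    {g₀ g₁ g₂ g₃ k₀ k₁ k₂ : ℝ} (h₃ : |g₃| ≤ K)
    (hk₀ : |k₀ - g₀ + h * g₁ - h ^ 2 / 2 * g₂| ≤ K * h ^ 3)
    (hk₁ : |k₁ - g₁ + h * g₂| ≤ K * h ^ 2) (hk₂ : |k₂ - g₂| ≤ K * h) (ξ : Fin 6) :
    |-(a * corrState h g₁ g₂ g₃ ξ)
      + a * n * upwind (corrState h g₀ g₁ g₂) (corrState h k₀ k₁ k₂) ξ| ≤ 20 * a * K * h ^ 2 := by
  obtain ⟨hc₀, hc₁, hc₂⟩ := abs_Lxm_mulVec_le ξ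
  have hup := upwind_corrState h g₀ g₁ g₂ k₀ k₁ k₂ ξ
  have hK : 0 ≤ K := (abs_nonneg _).trans h₃
  have hn0 : 0 ≤ n := by
    by_contra! hneg
    nlinarith
  set A := (Lxm *ᵥ 1) ξ * (k₀ - g₀ + h * g₁ - h ^ 2 / 2 * g₂) with hA
  set B := (Lxm *ᵥ corrOne) ξ * (h * (k₁ - g₁ + h * g₂)) with hB
  set C := (Lxm *ᵥ corrTwo) ξ * (h ^ 2 * (k₂ - g₂)) with hC
  have bA : |A| ≤ 6 * (K * h ^ 3) := by
    rw [hA, abs_mul]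
    exact mul_le_mul hc₀ hk₀ (abs_nonneg _) (by norm_num)
  have bB : |B| ≤ 6 * (h * (K * h ^ 2)) := by
    rw [hB, abs_mul, abs_mul, abs_of_nonneg hh]
    exact mul_le_mul hc₁ (mul_le_mul_of_nonneg_left hk₁ hh) (by positivity) (by norm_num)
  have bC : |C| ≤ 6 * (h ^ 2 * (K * h)) := by
    rw [hC, abs_mul, abs_mul, abs_of_nonneg (sq_nonneg h)]
    exact mul_le_mul hc₂ (mul_le_mul_of_nonneg_left hk₂ (sq_nonneg h)) (by positivity)
      (by norm_num)
  have bD : |corrTwo ξ * g₃| ≤ 2 * K := by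
    rw [abs_mul]
    exact mul_le_mul (abs_corrTwo_le ξ) h₃ (abs_nonneg _) (by norm_num)
  have heq : -(a * corrState h g₁ g₂ g₃ ξ)
      + a * n * upwind (corrState h g₀ g₁ g₂) (corrState h k₀ k₁ k₂) ξ
      = a * n * (A + B + C) - a * h ^ 2 * (corrTwo ξ * g₃) := by
    rw [hup, corrState]
    linear_combination (a * (g₁ + h * corrOne ξ * g₂)) * hn
  have hABC : |A + B + C| ≤ 18 * K * h ^ 3 := by
    linarith [abs_add_three A B C]
  rw [heq]
  calc _ ≤ |a * n * (A + B + C)| + |a * h ^ 2 * (corrTwo ξ * g₃)| := abs_sub _ _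
    _ = a * n * |A + B + C| + a * h ^ 2 * |corrTwo ξ * g₃| := by
      rw [abs_mul, abs_mul (a * h ^ 2), abs_of_nonneg (by positivity : 0 ≤ a * n),
        abs_of_nonneg (by positivity : 0 ≤ a * h ^ 2)]
    _ ≤ a * n * (18 * K * h ^ 3) + a * h ^ 2 * (2 * K) := by gcongr
    _ = 20 * a * K * h ^ 2 := by linear_combination (18 * a * K * h ^ 2) * hn

lemma Periodic2.fderiv_apply {v : ℝ × ℝ → ℝ} (hv : Periodic2 v) (d : ℝ × ℝ) :
    Periodic2 (fun p => fderiv ℝ v p d) := by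
  have aux : ∀ c : ℝ × ℝ, (∀ p, v (p + c) = v p) → ∀ p, fderiv ℝ v (p + c) d = fderiv ℝ v p d := by
    intro c hc p
    rw [← fderiv_comp_add_right, funext hc]
  constructor
  · intro x y
    simpa using aux (1, 0) (fun p => by simpa [Prod.add_def] using hv.1 p.1 p.2) (x, y)
  · intro x y
    simpa using aux (0, 1) (fun p => by simpa [Prod.add_def] using hv.2 p.1 p.2) (x, y)

lemma Periodic2.exists_bound {v : ℝ × ℝ → ℝ} (hv : Periodic2 v) (hc : Continuous v) :
    ∃ K, ∀ p, |v p| ≤ K := by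
  obtain ⟨K, hK⟩ := ((isCompact_Icc (a := (0 : ℝ)) (b := 1)).prod
    (isCompact_Icc (a := (0 : ℝ)) (b := 1))).exists_bound_of_continuousOn hc.continuousOn
  refine ⟨K, fun ⟨x, y⟩ => ?_⟩
  have hx : Function.Periodic (fun x => v (x, Int.fract y)) 1 := fun x => hv.1 x _
  have hy : Function.Periodic (fun y => v (x, y)) 1 := fun y => hv.2 x y
  have h1 : v (x, Int.fract y) = v (x, y) := by
    simpa only [mul_one, Int.self_sub_floor] using hy.sub_int_mul_eq (x := y) ⌊y⌋
  have h2 : v (Int.fract x, Int.fract y) = v (x, Int.fract y) := by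
    simpa only [mul_one, Int.self_sub_floor] using hx.sub_int_mul_eq (x := x) ⌊x⌋
  rw [← h1, ← h2]
  exact hK _ ⟨⟨Int.fract_nonneg x, (Int.fract_lt_one x).le⟩,
    ⟨Int.fract_nonneg y, (Int.fract_lt_one y).le⟩⟩

lemma hasDerivAt_fst_of_differentiable {v : ℝ × ℝ → ℝ} (hv : Differentiable ℝ v) (x y : ℝ) :
    HasDerivAt (fun s => v (s, y)) (fderiv ℝ v (x, y) (1, 0)) x :=
  (hv (x, y)).hasFDerivAt.comp_hasDerivAt x ((hasDerivAt_id x).prodMk (hasDerivAt_const x y))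

lemma hasDerivAt_snd_of_differentiable {v : ℝ × ℝ → ℝ} (hv : Differentiable ℝ v) (x y : ℝ) :
    HasDerivAt (fun s => v (x, s)) (fderiv ℝ v (x, y) (0, 1)) y :=
  (hv (x, y)).hasFDerivAt.comp_hasDerivAt y ((hasDerivAt_const y x).prodMk (hasDerivAt_id y))

lemma ContDiff.fderiv_apply_const {v : ℝ × ℝ → ℝ} {m n : WithTop ℕ∞} (hv : ContDiff ℝ n v)
    (hmn : m + 1 ≤ n) (d : ℝ × ℝ) : ContDiff ℝ m (fun p => fderiv ℝ v p d) :=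
  (hv.fderiv_right hmn).clm_apply contDiff_const

lemma abs_sub_le_of_abs_hasDerivAt_le {f f' : ℝ → ℝ} {K : ℝ} (hf : ∀ x, HasDerivAt f (f' x) x)
    (hK : ∀ x, |f' x| ≤ K) (x y : ℝ) : |f y - f x| ≤ K * |y - x| :=
  convex_univ.norm_image_sub_le_of_norm_hasDerivWithin_le
    (fun s _ => (hf s).hasDerivWithinAt) (fun s _ => hK s) (Set.mem_univ x) (Set.mem_univ y)

/-- A periodic `C³` function has bounded partial derivatives in the first variable up to
order three, and is Lipschitz. -/
lemma exists_partial_derivatives {v : ℝ × ℝ → ℝ} (hper : Periodic2 v) (hv : ContDiff ℝ 3 v) :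
    ∃ (v₁ v₂ v₃ : ℝ × ℝ → ℝ) (K : ℝ), 0 < K ∧
      Periodic2 v₁ ∧ Periodic2 v₂ ∧
      (∀ y x, HasDerivAt (fun s => v (s, y)) (v₁ (x, y)) x) ∧
      (∀ y x, HasDerivAt (fun s => v₁ (s, y)) (v₂ (x, y)) x) ∧
      (∀ y x, HasDerivAt (fun s => v₂ (s, y)) (v₃ (x, y)) x) ∧
      (∀ p, |v₁ p| ≤ K) ∧ (∀ p, |v₂ p| ≤ K) ∧ (∀ p, |v₃ p| ≤ K) ∧
      (∀ x y y', |v (x, y') - v (x, y)| ≤ K * |y' - y|) := by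
  set D : (ℝ × ℝ → ℝ) → ℝ × ℝ → ℝ := fun w p => fderiv ℝ w p (1, 0) with hD
  have c1 : ContDiff ℝ 2 (D v) := hv.fderiv_apply_const (by norm_num) _
  have c2 : ContDiff ℝ 1 (D (D v)) := c1.fderiv_apply_const (by norm_num) _
  have c3 : ContDiff ℝ 0 (D (D (D v))) := c2.fderiv_apply_const (by norm_num) _
  have cy : ContDiff ℝ 2 (fun p => fderiv ℝ v p (0, 1)) := hv.fderiv_apply_const (by norm_num) _
  have p1 : Periodic2 (D v) := hper.fderiv_apply _
  have p2 : Periodic2 (D (D v)) := p1.fderiv_apply _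
  have p3 : Periodic2 (D (D (D v))) := p2.fderiv_apply _
  obtain ⟨K1, h1⟩ := p1.exists_bound c1.continuous
  obtain ⟨K2, h2⟩ := p2.exists_bound c2.continuous
  obtain ⟨K3, h3⟩ := p3.exists_bound c3.continuous
  obtain ⟨Ky, hy⟩ := (hper.fderiv_apply (0, 1)).exists_bound cy.continuous
  have hle : ∀ B ∈ ({K1, K2, K3, Ky} : Set ℝ), B ≤ |K1| + |K2| + |K3| + |Ky| + 1 := by
    have := abs_nonneg K1
    have := abs_nonneg K2
    have := abs_nonneg K3
    have := abs_nonneg Ky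
    rintro B (rfl | rfl | rfl | rfl) <;> linarith [le_abs_self B]
  refine ⟨D v, D (D v), D (D (D v)), |K1| + |K2| + |K3| + |Ky| + 1, by positivity, p1, p2,
    fun y x => hasDerivAt_fst_of_differentiable (hv.differentiable (by norm_num)) x y,
    fun y x => hasDerivAt_fst_of_differentiable (c1.differentiable (by norm_num)) x y,
    fun y x => hasDerivAt_fst_of_differentiable (c2.differentiable (by norm_num)) x y,
    fun p => (h1 p).trans (hle _ (by simp)), fun p => (h2 p).trans (hle _ (by simp)),
    fun p => (h3 p).trans (hle _ (by simp)), fun x y y' => ?_⟩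
  exact abs_sub_le_of_abs_hasDerivAt_le
    (hasDerivAt_snd_of_differentiable (hv.differentiable (by norm_num)) x)
    (fun s => (hy (x, s)).trans (hle _ (by simp))) y y'

lemma Periodic2.eval_val_sub_one {N : ℕ} [NeZero N] {v : ℝ × ℝ → ℝ} (hv : Periodic2 v)
    (i : ZMod N) (s y : ℝ) :
    v (((i + -1).val : ℝ) / N - s, y) = v ((i.val : ℝ) / N - s - 1 / N, y) := by
  have hN : (N : ℝ) ≠ 0 := Nat.cast_ne_zero.2 (NeZero.ne N)
  obtain ⟨k, hk⟩ : (N : ℤ) ∣ ((i + -1).val : ℤ) - ((i.val : ℤ) - 1) := by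
    rw [← ZMod.intCast_zmod_eq_zero_iff_dvd]
    push_cast
    simp
  have hk' : ((i + -1).val : ℝ) = (i.val : ℝ) - 1 + N * k := by
    have : ((((i + -1).val : ℤ) - ((i.val : ℤ) - 1) : ℤ) : ℝ) = ((N * k : ℤ) : ℝ) := by rw [hk]
    push_cast at this
    linarith
  have hp : Function.Periodic (fun x => v (x, y)) 1 := fun x => hv.1 x y
  have := hp.int_mul k ((i.val : ℝ) / N - s - 1 / N)
  simp only [mul_one] at this
  rw [← this, hk']
  congr 2
  field_simp
  ring

lemma IsSol.hasDerivAt {ω : ℝ × ℝ} (hω : ω.2 = 0) {N : ℕ} [NeZero N] {u : ℝ → Mesh N}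
    (hu : IsSol ω N u) (η : ZMod N × ZMod N) (ξ : Fin 6) (t : ℝ) :
    HasDerivAt (fun s => u s η ξ) (-(ω.1 * N * upwind (u t η) (u t (η + (-1, 0))) ξ)) t := by
  refine ((hasDerivAt_pi.1 (hu η t)) ξ).congr_deriv ?_
  simp only [L00, Lm0, L0m, hω, zero_smul, add_zero, Matrix.zero_mulVec, upwind,
    Matrix.smul_mulVec, Pi.neg_apply, Pi.smul_apply, Pi.add_apply, smul_eq_mul]
  ring

lemma apt_mem_unit (ξ : Fin 6) :
    0 ≤ (apt ξ).1 ∧ (apt ξ).1 ≤ 1 ∧ 0 ≤ (apt ξ).2 ∧ (apt ξ).2 ≤ 1 := by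
  fin_cases ξ <;> simp [apt]

lemma meshNorm_le_of_energy {N : ℕ} [NeZero N] {e d w : Mesh N} {A B C : ℝ} (hC : 0 ≤ C)
    (hw : w = e + d) (he : meshEnergy N e ≤ A ^ 2) (hd : ∀ η ξ, |d η ξ| ≤ B)
    (hABC : A ^ 2 + 12 * B ^ 2 ≤ C ^ 2) : meshNorm N w ≤ C := by
  refine Real.sqrt_le_iff.2 ⟨hC, le_trans ?_ hABC⟩
  have hterm : ∀ η, ((1 : ℝ) / N) ^ 2 * ∑ ξ, w η ξ ^ 2
      ≤ ((1 : ℝ) / N) ^ 2 * blockInner (e η) (e η) + ((1 : ℝ) / N) ^ 2 * (12 * B ^ 2) := by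
    intro η
    rw [← mul_add]
    refine mul_le_mul_of_nonneg_left ?_ (sq_nonneg _)
    have h1 : ∑ ξ, w η ξ ^ 2 ≤ ∑ ξ, (2 * e η ξ ^ 2 + 2 * B ^ 2) := by
      refine Finset.sum_le_sum fun ξ _ => ?_
      have : d η ξ ^ 2 ≤ B ^ 2 := sq_le_sq' (abs_le.1 (hd η ξ)).1 (abs_le.1 (hd η ξ)).2
      rw [hw, Pi.add_apply, Pi.add_apply]
      nlinarith [sq_nonneg (e η ξ - d η ξ)]
    rw [Finset.sum_add_distrib, ← Finset.mul_sum] at h1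
    simp only [Finset.sum_const, Finset.card_univ, Fintype.card_fin, nsmul_eq_mul] at h1
    have h2 := sum_sq_le_blockInner_self (e η)
    have h3 := blockInner_self_nonneg (e η)
    push_cast at h1
    linarith
  calc _ ≤ _ := Finset.sum_le_sum fun η _ => hterm η
    _ = meshEnergy N e + 12 * B ^ 2 := by
      rw [Finset.sum_add_distrib, sum_mesh_const, meshEnergy]
    _ ≤ _ := by linarith

/-- The corrected projection differs from point evaluation by `O(h)`. -/
lemma abs_corrState_sub_eval_le {v v₁ v₂ : ℝ × ℝ → ℝ} {K h : ℝ} (hh : 0 ≤ h) (hh1 : h ≤ 1)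
    (hv : ∀ y x, HasDerivAt (fun s => v (s, y)) (v₁ (x, y)) x)
    (hK₁ : ∀ p, |v₁ p| ≤ K) (hK₂ : ∀ p, |v₂ p| ≤ K)
    (hy : ∀ x y y', |v (x, y') - v (x, y)| ≤ K * |y' - y|) (x y : ℝ) (ξ : Fin 6) :
    |corrState h (v (x, y)) (v₁ (x, y)) (v₂ (x, y)) ξ
      - v (x + (apt ξ).1 * h, y + (apt ξ).2 * h)| ≤ 6 * (K * h) := by
  have hK : 0 ≤ K := (abs_nonneg _).trans (hK₁ 0)
  obtain ⟨ha, ha', hb, hb'⟩ := apt_mem_unit ξ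
  set x' := x + (apt ξ).1 * h with hx'
  set y' := y + (apt ξ).2 * h with hy'
  have e1 : |v (x', y) - v (x, y)| ≤ K * h := by
    refine (abs_sub_le_of_abs_hasDerivAt_le (hv y) (fun s => hK₁ (s, y)) x x').trans ?_
    refine mul_le_mul_of_nonneg_left ?_ hK
    rw [hx', add_sub_cancel_left, abs_of_nonneg (by positivity)]
    exact mul_le_of_le_one_left hh ha'
  have e2 : |v (x', y') - v (x', y)| ≤ K * h := by
    refine (hy x' y y').trans (mul_le_mul_of_nonneg_left ?_ hK)
    rw [hy', add_sub_cancel_left, abs_of_nonneg (by positivity)]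
    exact mul_le_of_le_one_left hh hb'
  have e3 : |h * corrOne ξ * v₁ (x, y)| ≤ h * 2 * K := by
    rw [abs_mul, abs_mul, abs_of_nonneg hh]
    exact mul_le_mul (mul_le_mul_of_nonneg_left (abs_corrOne_le ξ) hh) (hK₁ _) (abs_nonneg _)
      (by positivity)
  have e4 : |h ^ 2 * corrTwo ξ * v₂ (x, y)| ≤ h * 2 * K := by
    rw [abs_mul, abs_mul, abs_of_nonneg (sq_nonneg h)]
    have : h ^ 2 ≤ h := by nlinarith
    exact mul_le_mul (mul_le_mul this (abs_corrTwo_le ξ) (abs_nonneg _) hh) (hK₂ _)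
      (abs_nonneg _) (by positivity)
  rw [abs_le] at *
  unfold corrState
  constructor <;> linarith [e1.1, e1.2, e2.1, e2.2, e3.1, e3.2, e4.1, e4.2]

/-- For `ω_x > 0`, `ω_y = 0`, and every 1-periodic `v0 ∈ C³(ℝ²)` there is
a constant `c` such that `‖ε_h(t, v0)‖ ≤ c (h + t h²)` for all `N` and `t ≥ 0`
(second-order accuracy in long-time simulation). -/
theorem sdrt1_long_time_second_order (ω : ℝ × ℝ) (hx : 0 < ω.1) (hy : ω.2 = 0)
    (v0 : ℝ × ℝ → ℝ) (hper : Periodic2 v0) (hsm : ContDiff ℝ 3 v0) :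
    ∃ c : ℝ, ∀ (N : ℕ) [NeZero N], ∀ u : ℝ → Mesh N, IsSol ω N u → u 0 = Pih N v0 →
      ∀ t : ℝ, 0 ≤ t →
        meshNorm N (u t - Pih N (fun r => v0 (r - t • ω)))
          ≤ c * ((1 : ℝ) / N + t * ((1 : ℝ) / N) ^ 2) := by
  obtain ⟨v₁, v₂, v₃, K, hK, hp₁, hp₂, hd₀, hd₁, hd₂, hK₁, hK₂, hK₃, hLip⟩ :=
    exists_partial_derivatives hper hsm
  refine ⟨60 * K + 160 * ω.1 * K, fun N _ u hu hu0 t ht => ?_⟩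
  have hN : (0 : ℝ) < N := Nat.cast_pos.2 (NeZero.pos N)
  have hN1 : (1 : ℝ) ≤ N := Nat.one_le_cast.2 (NeZero.pos N)
  set h : ℝ := 1 / N with hh
  have hh0 : 0 < h := by positivity
  have hh1 : h ≤ 1 := by rw [hh, div_le_one hN]; exact hN1
  have hNh : (N : ℝ) * h = 1 := by rw [hh]; field_simp
  set X : ZMod N × ZMod N → ℝ → ℝ := fun η t => (η.1.val : ℝ) / N - t * ω.1 with hX
  set Y : ZMod N × ZMod N → ℝ := fun η => (η.2.val : ℝ) / N with hY
  set W : ℝ → Mesh N := fun t η =>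
    corrState h (v0 (X η t, Y η)) (v₁ (X η t, Y η)) (v₂ (X η t, Y η)) with hW
  set W' : ℝ → Mesh N := fun t η =>
    corrState h (v₁ (X η t, Y η)) (v₂ (X η t, Y η)) (v₃ (X η t, Y η)) with hW'
  set r : ℝ → Mesh N := fun t η ξ =>
    -(ω.1 * W' t η ξ) + ω.1 * N * upwind (W t η) (W t (η + (-1, 0))) ξ with hr
  have hWshift : ∀ t η, W t (η + (-1, 0)) =
      corrState h (v0 (X η t - h, Y η)) (v₁ (X η t - h, Y η)) (v₂ (X η t - h, Y η)) := by
    intro t η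
    simp only [hW, hX, hY, hh, Prod.fst_add, Prod.snd_add, add_zero, hper.eval_val_sub_one,
      hp₁.eval_val_sub_one, hp₂.eval_val_sub_one]
  have hres : ∀ t η ξ, |r t η ξ| ≤ 20 * ω.1 * K * h ^ 2 := by
    intro t η ξ
    simp only [hr, hWshift]
    exact abs_corrState_residual_le hx.le hh0.le hNh (hK₃ _)
      (abs_backward_taylor_two_le hh0.le (hd₀ (Y η)) (hd₁ (Y η)) (hd₂ (Y η))
        (fun x => hK₃ (x, Y η)) _)
      (abs_backward_taylor_one_le hh0.le (hd₁ (Y η)) (hd₂ (Y η)) (fun x => hK₃ (x, Y η)) _)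
      (abs_backward_diff_le hh0.le (hd₂ (Y η)) (fun x => hK₃ (x, Y η)) _) ξ
  have hWderiv : ∀ η ξ t, HasDerivAt (fun s => W s η ξ) (-(ω.1 * W' t η ξ)) t := by
    intro η ξ t
    have hXd : HasDerivAt (X η) (-ω.1) t := by
      simpa [hX] using ((hasDerivAt_id t).mul_const ω.1).const_sub ((η.1.val : ℝ) / N)
    have a₀ := (hd₀ (Y η) (X η t)).comp t hXd
    have a₁ := ((hd₁ (Y η) (X η t)).comp t hXd).const_mul (h * corrOne ξ)
    have a₂ := ((hd₂ (Y η) (X η t)).comp t hXd).const_mul (h ^ 2 * corrTwo ξ)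
    refine ((a₀.fun_add a₁).fun_add a₂).congr_deriv ?_
    simp only [hW', corrState]
    ring
  have hderiv : ∀ η ξ t, HasDerivAt (fun s => (u s - W s) η ξ)
      (-(ω.1 * N * upwind ((u t - W t) η) ((u t - W t) (η + (-1, 0))) ξ) - r t η ξ) t := by
    intro η ξ t
    refine ((hu.hasDerivAt hy η ξ t).fun_sub (hWderiv η ξ t)).congr_deriv ?_
    rw [Pi.sub_apply, Pi.sub_apply, upwind_sub, Pi.sub_apply]
    simp only [hr]
    ring
  have hproj : ∀ t η ξ, |(W t - Pih N (fun r => v0 (r - t • ω))) η ξ| ≤ 6 * (K * h) := by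
    intro t η ξ
    have hpt : Pih N (fun r => v0 (r - t • ω)) η ξ
        = v0 (X η t + (apt ξ).1 * h, Y η + (apt ξ).2 * h) := by
      simp only [Pih, hX, hY, hh]
      congr 1
      ext
      · simp; ring
      · simp [hy]; ring
    rw [Pi.sub_apply, Pi.sub_apply, hpt]
    exact abs_corrState_sub_eval_le hh0.le hh1 hd₀ hK₁ hK₂ hLip _ _ ξ
  have hinit : meshEnergy N (u 0 - W 0) + (K * h) ^ 2 ≤ (50 * (K * h)) ^ 2 := by
    have hE : meshEnergy N (u 0 - W 0) ≤ 54 * (6 * (K * h)) ^ 2 := by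
      refine sum_mesh_le N fun η => blockInner_self_le _ fun ξ => ?_
      have := hproj 0 η ξ
      rw [Pi.sub_apply, Pi.sub_apply, hu0, abs_sub_comm]
      simpa using this
    nlinarith [sq_nonneg (K * h)]
  have hstab := sqrt_meshEnergy_le (δ := (K * h) ^ 2) (ρ := 160 * ω.1 * K * h ^ 2) (r := r)
    (e := fun t => u t - W t) hx.le (by positivity) (by positivity) hderiv
    (fun t η => (blockInner_self_le _ (hres t η)).trans
      (by nlinarith [sq_nonneg (ω.1 * K * h ^ 2)])) ht
  have hA : meshEnergy N (u t - W t) ≤ (50 * (K * h) + 160 * ω.1 * K * h ^ 2 * t) ^ 2 := by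
    have h0 : √(meshEnergy N (u 0 - W 0) + (K * h) ^ 2) ≤ 50 * (K * h) :=
      Real.sqrt_le_iff.2 ⟨by positivity, hinit⟩
    have h1 := (Real.sqrt_le_iff.1 (hstab.trans (add_le_add_left h0 _))).2
    linarith [sq_nonneg (K * h)]
  refine meshNorm_le_of_energy (by positivity) (sub_add_sub_cancel _ (W t) _).symm hA
    (hproj t) ?_
  have hle : 60 * (K * h) + 160 * ω.1 * K * h ^ 2 * t
      ≤ (60 * K + 160 * ω.1 * K) * (h + t * h ^ 2) := by
    have : 0 ≤ 60 * K * (t * h ^ 2) + 160 * ω.1 * K * h := by positivity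
    linarith
  refine le_trans ?_ (pow_le_pow_left₀ (by positivity) hle 2)
  have : 0 ≤ (K * h) * (160 * ω.1 * K * h ^ 2 * t) := by positivity
  nlinarith [sq_nonneg (K * h)]


end
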